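/- Let H n := Nat.card {t : Term // Hnf t ∧ size t = n} be the number of λ-terms in head normal form of natural size n. Then (H n : ℝ) · ρⁿ · n^{3/2} tends, as n → ∞, to the constant C_H = √(ρ·(3 + 2ρ + 3ρ²)/(1 − ρ)) / (4·(1 − ρ)·√π) (numerically C_H ≈ 0.2546259), i.e. H n ∼ (1/ρ)ⁿ · C_H · n^{−3/2}. -/

import Mathlib

inductive Term : Type
  | idx : ℕ → Term
  | app : Term → Term → Term
  | abs : Term → Term

def Term.size : Term → ℕ
  | .idx n => n + 1
  | .app t u => t.size + u.size + 1
  | .abs t => t.size + 1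

inductive Nhnf : Term → Prop
  | idx (n : ℕ) : Nhnf (.idx n)
  | app {t : Term} (u : Term) : Nhnf t → Nhnf (.app t u)

inductive Hnf : Term → Prop
  | of {t : Term} : Nhnf t → Hnf t
  | abs {t : Term} : Hnf t → Hnf (.abs t)

noncomputable def H (n : ℕ) : ℕ := Nat.card {t : Term // Hnf t ∧ t.size = n}

open PowerSeries Filter Topology
open Finset.HasAntidiagonal (antidiagonal)

section Counting

abbrev SizedTerm (n : ℕ) : Type := {t : Term // t.size = n}

abbrev SizedNhnf (n : ℕ) : Type := {t : Term // Nhnf t ∧ t.size = n}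

abbrev SizedHnf (n : ℕ) : Type := {t : Term // Hnf t ∧ t.size = n}

lemma Term.size_pos (t : Term) : 0 < t.size := by
  cases t <;> simp [Term.size]

noncomputable def sizedTermEquiv (n : ℕ) :
    (Unit ⊕ SizedTerm n) ⊕
      (Σ p : antidiagonal n, SizedTerm p.1.1 × SizedTerm p.1.2) ≃
    SizedTerm (n + 1) :=
  Equiv.ofBijective
    (Sum.elim
      (Sum.elim (fun _ => ⟨.idx n, by simp [Term.size]⟩)
        (fun t => ⟨.abs t.1, by simp [Term.size, t.2]⟩))
      (fun x => ⟨.app x.2.1.1 x.2.2.1, by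
        simpa [Term.size, x.2.1.2, x.2.2.2] using Finset.HasAntidiagonal.mem_antidiagonal.1 x.1.2⟩))
    (by
      constructor
      · rintro ((_ | ⟨t, ht⟩) | ⟨⟨⟨i, j⟩, hp⟩, ⟨t, ht⟩, ⟨u, hu⟩⟩)
          ((_ | ⟨t', ht'⟩) | ⟨⟨⟨i', j'⟩, hp'⟩, ⟨t', ht'⟩, ⟨u', hu'⟩⟩) h <;>
          replace h := congrArg Subtype.val h <;> simp at h ⊢
        · exact h
        · obtain ⟨rfl, rfl⟩ := h
          dsimp only at ht hu ht' hu'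
          subst ht hu ht' hu'
          simp
      · rintro ⟨t, ht⟩
        cases t with
        | idx k =>
          simp only [Term.size] at ht
          obtain rfl : k = n := by omega
          exact ⟨.inl (.inl ()), rfl⟩
        | abs t =>
          simp only [Term.size] at ht
          exact ⟨.inl (.inr ⟨t, by omega⟩), rfl⟩
        | app t u =>
          simp only [Term.size] at ht
          exact ⟨.inr ⟨⟨(t.size, u.size), by simp; omega⟩, ⟨t, rfl⟩, ⟨u, rfl⟩⟩, rfl⟩)

noncomputable def sizedNhnfEquiv (n : ℕ) :
    Unit ⊕ (Σ p : antidiagonal n, SizedNhnf p.1.1 × SizedTerm p.1.2) ≃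
    SizedNhnf (n + 1) :=
  Equiv.ofBijective
    (Sum.elim (fun _ => ⟨.idx n, .idx n, by simp [Term.size]⟩)
      (fun x => ⟨.app x.2.1.1 x.2.2.1, .app _ x.2.1.2.1, by
        simpa [Term.size, x.2.1.2.2, x.2.2.2] using Finset.HasAntidiagonal.mem_antidiagonal.1 x.1.2⟩))
    (by
      constructor
      · rintro (_ | ⟨⟨⟨i, j⟩, hp⟩, ⟨t, hn, ht⟩, ⟨u, hu⟩⟩)
          (_ | ⟨⟨⟨i', j'⟩, hp'⟩, ⟨t', hn', ht'⟩, ⟨u', hu'⟩⟩) h <;>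
          simp at h ⊢
        obtain ⟨rfl, rfl⟩ := h
        dsimp only at ht hu ht' hu'
        subst ht hu ht' hu'
        simp
      · rintro ⟨t, hn, ht⟩
        cases hn with
        | idx k =>
          simp only [Term.size] at ht
          obtain rfl : k = n := by omega
          exact ⟨.inl (), rfl⟩
        | @app t u hn =>
          simp only [Term.size] at ht
          exact ⟨.inr ⟨⟨(t.size, u.size), by simp; omega⟩, ⟨t, hn, rfl⟩, ⟨u, rfl⟩⟩, rfl⟩)

noncomputable def sizedHnfEquiv (n : ℕ) :
    SizedNhnf (n + 1) ⊕ SizedHnf n ≃ SizedHnf (n + 1) :=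
  Equiv.ofBijective
    (Sum.elim (fun t => ⟨t.1, .of t.2.1, t.2.2⟩)
      (fun t => ⟨.abs t.1, .abs t.2.1, by simp [Term.size, t.2.2]⟩))
    (by
      constructor
      · rintro (⟨t, hn, ht⟩ | ⟨t, hn, ht⟩) (⟨t', hn', ht'⟩ | ⟨t', hn', ht'⟩) h <;>
          simp at h ⊢
        · exact h
        · subst h; cases hn
        · subst h; cases hn'
        · exact h
      · rintro ⟨t, hn, ht⟩
        cases hn with
        | of hn => exact ⟨.inl ⟨t, hn, ht⟩, rfl⟩
        | @abs t hn =>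
          simp only [Term.size] at ht
          exact ⟨.inr ⟨t, hn, by omega⟩, rfl⟩)

instance (n : ℕ) : Finite (SizedTerm n) := by
  induction n using Nat.strong_induction_on with
  | _ n ih =>
    cases n with
    | zero =>
      have : IsEmpty (SizedTerm 0) := ⟨fun t => t.1.size_pos.ne' t.2⟩
      infer_instance
    | succ n =>
      have := ih n n.lt_succ_self
      have (p : antidiagonal n) : Finite (SizedTerm p.1.1 × SizedTerm p.1.2) := by
        have := ih p.1.1 (Nat.lt_succ_of_le (Finset.HasAntidiagonal.antidiagonal.fst_le p.2))
        have := ih p.1.2 (Nat.lt_succ_of_le (Finset.HasAntidiagonal.antidiagonal.snd_le p.2))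
        infer_instance
      exact Finite.of_equiv _ (sizedTermEquiv n)

instance (n : ℕ) : Finite (SizedNhnf n) :=
  Finite.of_injective (fun t => (⟨t.1, t.2.2⟩ : SizedTerm n))
    fun _ _ h => Subtype.ext (congrArg (fun x : SizedTerm n => x.1) h)

instance (n : ℕ) : Finite (SizedHnf n) :=
  Finite.of_injective (fun t => (⟨t.1, t.2.2⟩ : SizedTerm n))
    fun _ _ h => Subtype.ext (congrArg (fun x : SizedTerm n => x.1) h)

lemma card_sizedTerm_zero : Nat.card (SizedTerm 0) = 0 :=
  have : IsEmpty (SizedTerm 0) := ⟨fun t => t.1.size_pos.ne' t.2⟩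
  Nat.card_of_isEmpty

lemma card_sizedNhnf_zero : Nat.card (SizedNhnf 0) = 0 :=
  have : IsEmpty (SizedNhnf 0) := ⟨fun t => t.1.size_pos.ne' t.2.2⟩
  Nat.card_of_isEmpty

lemma H_zero : H 0 = 0 :=
  have : IsEmpty (SizedHnf 0) := ⟨fun t => t.1.size_pos.ne' t.2.2⟩
  Nat.card_of_isEmpty

lemma card_sizedTerm_succ (n : ℕ) :
    Nat.card (SizedTerm (n + 1)) = 1 + Nat.card (SizedTerm n) +
      ∑ p ∈ antidiagonal n, Nat.card (SizedTerm p.1) * Nat.card (SizedTerm p.2) := by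
  rw [← Nat.card_congr (sizedTermEquiv n), Nat.card_sum, Nat.card_sum, Nat.card_sigma,
    ← Finset.sum_coe_sort (antidiagonal n)
      fun p => Nat.card (SizedTerm p.1) * Nat.card (SizedTerm p.2)]
  simp [Nat.card_prod]

lemma card_sizedNhnf_succ (n : ℕ) :
    Nat.card (SizedNhnf (n + 1)) = 1 +
      ∑ p ∈ antidiagonal n, Nat.card (SizedNhnf p.1) * Nat.card (SizedTerm p.2) := by
  rw [← Nat.card_congr (sizedNhnfEquiv n), Nat.card_sum, Nat.card_sigma,
    ← Finset.sum_coe_sort (antidiagonal n)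
      fun p => Nat.card (SizedNhnf p.1) * Nat.card (SizedTerm p.2)]
  simp [Nat.card_prod]

lemma H_succ (n : ℕ) : H (n + 1) = Nat.card (SizedNhnf (n + 1)) + H n := by
  rw [H, ← Nat.card_congr (sizedHnfEquiv n), Nat.card_sum]
  rfl

end Counting

section GeneratingFunctions

noncomputable def termSeries : ℝ⟦X⟧ := mk fun n => (Nat.card (SizedTerm n) : ℝ)

noncomputable def nhnfSeries : ℝ⟦X⟧ := mk fun n => (Nat.card (SizedNhnf n) : ℝ)

noncomputable def hnfSeries : ℝ⟦X⟧ := mk fun n => (H n : ℝ)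

lemma termSeries_eq :
    termSeries = X * (mk (fun _ => (1 : ℝ)) + termSeries + termSeries * termSeries) := by
  ext n
  cases n with
  | zero => simp [termSeries, card_sizedTerm_zero]
  | succ n =>
    rw [coeff_succ_X_mul]
    simp [termSeries, card_sizedTerm_succ, coeff_mul]

lemma nhnfSeries_eq :
    nhnfSeries = X * (mk (fun _ => (1 : ℝ)) + nhnfSeries * termSeries) := by
  ext n
  cases n with
  | zero => simp [nhnfSeries, card_sizedNhnf_zero]
  | succ n =>
    rw [coeff_succ_X_mul]
    simp [nhnfSeries, termSeries, card_sizedNhnf_succ, coeff_mul]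

lemma hnfSeries_eq : hnfSeries = nhnfSeries + X * hnfSeries := by
  ext n
  cases n with
  | zero => simp [hnfSeries, nhnfSeries, H_zero, card_sizedNhnf_zero]
  | succ n => simp [coeff_succ_X_mul, hnfSeries, nhnfSeries, H_succ]

/-- The square root of the discriminant of the quadratic equation for `termSeries`. -/
noncomputable def discSqrt : ℝ⟦X⟧ := 1 - X - 2 * X * termSeries

lemma discSqrt_sq_mul : discSqrt ^ 2 * (1 - X) = 1 - 3 * X - X ^ 2 - X ^ 3 := by
  have hg : mk (fun _ => (1 : ℝ)) * (1 - X) = 1 := mk_one_mul_one_sub_eq_one ℝ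
  have hL := termSeries_eq
  rw [discSqrt]
  linear_combination (-4 * X * (1 - X)) * hL - 4 * X ^ 2 * hg

lemma nhnfSeries_eq_termSeries : nhnfSeries = X + X * termSeries := by
  have hg : mk (fun _ => (1 : ℝ)) * (1 - X) = 1 := mk_one_mul_one_sub_eq_one ℝ
  have hL := termSeries_eq
  have hK := nhnfSeries_eq
  have h0 : (1 - X * termSeries : ℝ⟦X⟧) ≠ 0 := fun h => by
    simpa using congrArg constantCoeff h
  apply mul_right_cancel₀ h0
  linear_combination hK - X * hL + X * hg

lemma two_mul_hnfSeries_mul : 2 * hnfSeries * (1 - X) = 1 + X - discSqrt := by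
  rw [discSqrt]
  linear_combination 2 * hnfSeries_eq + 2 * nhnfSeries_eq_termSeries

end GeneratingFunctions

section Convolution

lemma tendsto_add_div_add_rpow (a b : ℝ) :
    Tendsto (fun n : ℕ => (((n : ℝ) + a) / (n + b)) ^ (3 / 2 : ℝ)) atTop (𝓝 1) := by
  have hb : Tendsto (fun n : ℕ => (n : ℝ) + b) atTop atTop :=
    tendsto_atTop_add_const_right _ _ tendsto_natCast_atTop_atTop
  have h : Tendsto (fun n : ℕ => ((n : ℝ) + a) / (n + b)) atTop (𝓝 1) := by
    have h1 : Tendsto (fun n : ℕ => 1 + (a - b) / ((n : ℝ) + b)) atTop (𝓝 (1 + 0)) :=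
      tendsto_const_nhds.add (tendsto_const_nhds.div_atTop hb)
    rw [add_zero] at h1
    refine h1.congr' ?_
    filter_upwards [hb.eventually_gt_atTop 0] with n hn
    field_simp
    ring
  simpa using h.rpow_const (p := (3 / 2 : ℝ)) (Or.inr (by norm_num))

lemma tendsto_rpow_weight_congr {f : ℕ → ℝ} {c a b : ℝ} (ha : 0 ≤ a) (hb : 0 ≤ b)
    (h : Tendsto (fun n : ℕ => f n * ((n : ℝ) + b) ^ (3 / 2 : ℝ)) atTop (𝓝 c)) :
    Tendsto (fun n : ℕ => f n * ((n : ℝ) + a) ^ (3 / 2 : ℝ)) atTop (𝓝 c) := by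
  have h1 := h.mul (tendsto_add_div_add_rpow a b)
  rw [mul_one] at h1
  refine h1.congr' ?_
  filter_upwards [eventually_gt_atTop 0] with n hn
  have hn' : (0 : ℝ) < n := by exact_mod_cast hn
  rw [mul_assoc, ← Real.mul_rpow (by positivity) (by positivity),
    mul_div_cancel₀ _ (by positivity)]

/-- Multiplying by a rapidly decaying series preserves the `n ^ (-3 / 2)` decay rate
of coefficients. -/
lemma tendsto_coeff_mul_rpow {a b : ℝ⟦X⟧} {c : ℝ}
    (ha : Tendsto (fun n : ℕ => coeff n a * ((n : ℝ) + 1) ^ (3 / 2 : ℝ)) atTop (𝓝 c))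
    (hb : Summable fun n : ℕ => |coeff n b| * ((n : ℝ) + 1) ^ (3 / 2 : ℝ)) :
    Tendsto (fun n : ℕ => coeff n (a * b) * ((n : ℝ) + 1) ^ (3 / 2 : ℝ)) atTop
      (𝓝 (c * ∑' k, coeff k b)) := by
  obtain ⟨M, hM⟩ := ha.abs.bddAbove_range
  have hM' (n : ℕ) : |coeff n a| * ((n : ℝ) + 1) ^ (3 / 2 : ℝ) ≤ M := by
    have := hM (Set.mem_range_self n)
    rwa [abs_mul, abs_of_nonneg (a := ((n : ℝ) + 1) ^ (3 / 2 : ℝ)) (by positivity)] at this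
  have hM0 : 0 ≤ M := le_trans (by positivity) (hM' 0)
  let f : ℕ → ℕ → ℝ := fun n k =>
    if k ≤ n then coeff k b * coeff (n - k) a * ((n : ℝ) + 1) ^ (3 / 2 : ℝ) else 0
  have hsum (n : ℕ) : coeff n (a * b) * ((n : ℝ) + 1) ^ (3 / 2 : ℝ) = ∑' k, f n k := by
    rw [tsum_eq_sum (s := Finset.range (n + 1))
      (fun k hk => if_neg (by simpa using hk)), mul_comm a b, coeff_mul,
      Finset.Nat.sum_antidiagonal_eq_sum_range_succ (fun i j => coeff i b * coeff j a),
      Finset.sum_mul]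
    exact Finset.sum_congr rfl fun k hk => (if_pos (by simpa [Nat.lt_succ_iff] using hk)).symm
  simp_rw [hsum]
  rw [← tsum_mul_left]
  refine tendsto_tsum_of_dominated_convergence (hb.mul_left M) (fun k => ?_)
    (Eventually.of_forall fun n k => ?_)
  · rw [← tendsto_add_atTop_iff_nat k]
    have h1 := (ha.mul (tendsto_add_div_add_rpow (k + 1) 1)).const_mul (coeff k b)
    rw [mul_one, mul_comm (coeff k b)] at h1
    refine h1.congr fun m => ?_
    simp only [f, if_pos (Nat.le_add_left k m), Nat.add_sub_cancel, Nat.cast_add]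
    rw [mul_assoc (coeff m a), ← Real.mul_rpow (by positivity) (by positivity),
      mul_div_cancel₀ _ (by positivity), mul_assoc, add_assoc]
  · by_cases hk : k ≤ n
    · simp only [f, if_pos hk, Real.norm_eq_abs, abs_mul]
      rw [abs_of_nonneg (a := ((n : ℝ) + 1) ^ (3 / 2 : ℝ)) (by positivity)]
      obtain ⟨m, rfl⟩ := Nat.exists_eq_add_of_le hk
      rw [Nat.add_sub_cancel_left]
      have h1 : (((k + m : ℕ) : ℝ) + 1) ^ (3 / 2 : ℝ) ≤
          ((m : ℝ) + 1) ^ (3 / 2 : ℝ) * ((k : ℝ) + 1) ^ (3 / 2 : ℝ) := by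
        rw [← Real.mul_rpow (by positivity) (by positivity)]
        refine Real.rpow_le_rpow (by positivity) ?_ (by norm_num)
        push_cast
        nlinarith [mul_nonneg (Nat.cast_nonneg (α := ℝ) m) (Nat.cast_nonneg (α := ℝ) k)]
      calc |coeff k b| * |coeff m a| * (((k + m : ℕ) : ℝ) + 1) ^ (3 / 2 : ℝ)
          ≤ |coeff k b| * |coeff m a| *
            (((m : ℝ) + 1) ^ (3 / 2 : ℝ) * ((k : ℝ) + 1) ^ (3 / 2 : ℝ)) := by gcongr
        _ = (|coeff m a| * ((m : ℝ) + 1) ^ (3 / 2 : ℝ)) *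
            (|coeff k b| * ((k : ℝ) + 1) ^ (3 / 2 : ℝ)) := by ring
        _ ≤ M * (|coeff k b| * ((k : ℝ) + 1) ^ (3 / 2 : ℝ)) := by gcongr; exact hM' m
    · simp only [f, if_neg hk, norm_zero]
      positivity

lemma summable_pow_mul_rpow {r : ℝ} (hr : 0 < r) (hr1 : r < 1) :
    Summable fun n : ℕ => r ^ n * ((n : ℝ) + 1) ^ (3 / 2 : ℝ) := by
  have h := summable_pow_mul_geometric_of_norm_lt_one 2
    (show ‖r‖ < 1 by rwa [Real.norm_of_nonneg hr.le])
  rw [← summable_nat_add_iff 1] at h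
  refine Summable.of_nonneg_of_le (fun n => by positivity) (fun n => ?_) (h.mul_left r⁻¹)
  have h2 : ((n : ℝ) + 1) ^ (3 / 2 : ℝ) ≤ ((n : ℝ) + 1) ^ 2 := by
    rw [← Real.rpow_natCast]
    refine Real.rpow_le_rpow_of_exponent_le (by linarith [Nat.cast_nonneg (α := ℝ) n]) ?_
    norm_num
  calc r ^ n * ((n : ℝ) + 1) ^ (3 / 2 : ℝ) ≤ r ^ n * ((n : ℝ) + 1) ^ 2 := by gcongr
    _ = r⁻¹ * (((n + 1 : ℕ) : ℝ) ^ 2 * r ^ (n + 1)) := by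
      push_cast
      rw [pow_succ r]
      field_simp

lemma summable_coeff_mul_rpow {f : ℝ⟦X⟧} {r : ℝ} (hr : 0 < r) (hr1 : r < 1)
    (hf : ∀ n, |coeff n f| ≤ r ^ n) :
    Summable fun n : ℕ => |coeff n f| * ((n : ℝ) + 1) ^ (3 / 2 : ℝ) :=
  Summable.of_nonneg_of_le (fun n => by positivity)
    (fun n => by gcongr; exact hf n) (summable_pow_mul_rpow hr hr1)

lemma tendsto_pow_mul_rpow {r : ℝ} (hr : 0 < r) (hr1 : r < 1) :
    Tendsto (fun n : ℕ => r ^ n * ((n : ℝ) + 1) ^ (3 / 2 : ℝ)) atTop (𝓝 0) :=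
  (summable_pow_mul_rpow hr hr1).tendsto_atTop_zero

lemma tsum_coeff_mul {f g : ℝ⟦X⟧} (hf : Summable fun n => |coeff n f|)
    (hg : Summable fun n => |coeff n g|) :
    ∑' n, coeff n (f * g) = (∑' n, coeff n f) * ∑' n, coeff n g := by
  simp_rw [coeff_mul]
  exact (tsum_mul_tsum_eq_tsum_sum_antidiagonal_of_summable_norm
    (f := fun n => coeff n f) (g := fun n => coeff n g) hf hg).symm

end Convolution

section SquareRoot

/-- The power series expansion of `√(1 - X)`. -/
noncomputable def sqrtOneSub : ℝ⟦X⟧ :=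
  1 - C (1 / 2) * X * rescale (1 / 4) (map (Nat.castRingHom ℝ) catalanSeries)

lemma sqrtOneSub_sq : sqrtOneSub ^ 2 = 1 - X := by
  have h := congrArg (fun f => rescale (1 / 4 : ℝ) (map (Nat.castRingHom ℝ) f))
    catalanSeries_sq_mul_X_add_one
  simp only [map_add, map_mul, map_pow, map_X, map_one, rescale_X] at h
  have h2 : (C (1 / 2) : ℝ⟦X⟧) ^ 2 = C (1 / 4) := by rw [← map_pow]; norm_num
  have h3 : (C (1 / 2) : ℝ⟦X⟧) * 2 = 1 := by
    rw [show (2 : ℝ⟦X⟧) = C 2 from (map_ofNat C 2).symm, ← map_mul]; norm_num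
  rw [sqrtOneSub]
  linear_combination X * h +
    X ^ 2 * (rescale (1 / 4 : ℝ) (map (Nat.castRingHom ℝ) catalanSeries)) ^ 2 * h2 -
    X * rescale (1 / 4 : ℝ) (map (Nat.castRingHom ℝ) catalanSeries) * h3

lemma constantCoeff_sqrtOneSub : constantCoeff sqrtOneSub = 1 := by
  simp [sqrtOneSub]

lemma coeff_succ_sqrtOneSub (n : ℕ) :
    coeff (n + 1) sqrtOneSub = -(n.centralBinom / 4 ^ n / (2 * (n + 1))) := by
  have h : ((n : ℝ) + 1) * catalan n = n.centralBinom := by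
    exact_mod_cast succ_mul_catalan_eq_centralBinom n
  rw [sqrtOneSub, mul_assoc, map_sub, coeff_C_mul, coeff_succ_X_mul, coeff_rescale, coeff_map,
    catalanSeries_coeff, ← h]
  simp [coeff_one]
  field_simp

lemma tendsto_centralBinom_mul_sqrt :
    Tendsto (fun n : ℕ => (n.centralBinom : ℝ) / 4 ^ n * √(n : ℝ)) atTop (𝓝 (1 / √Real.pi)) := by
  have hW := Real.Wallis.tendsto_W_nhds_pi_div_two
  have h1 := (Stirling.tendsto_self_div_two_mul_self_add_one.div hW (by positivity)).sqrt
  have h2 : √(1 / 2 / (Real.pi / 2)) = 1 / √Real.pi := by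
    rw [← Real.sqrt_one, ← Real.sqrt_div zero_le_one]
    congr 1
    field_simp
    simp
  rw [h2] at h1
  refine h1.congr fun n => ?_
  rw [← Real.sqrt_sq (show 0 ≤ (n.centralBinom : ℝ) / 4 ^ n by positivity),
    ← Real.sqrt_mul (by positivity)]
  congr 1
  have h3 : (n.centralBinom : ℝ) = (2 * n).factorial / (n.factorial * n.factorial) := by
    rw [Nat.centralBinom_eq_two_mul_choose, Nat.cast_choose ℝ (by omega)]
    congr 4
    omega
  have h4 : (4 : ℝ) ^ n = (2 ^ n) ^ 2 := by rw [← pow_mul, mul_comm, pow_mul]; norm_num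
  rw [Pi.div_apply, Real.Wallis.W_eq_factorial_ratio, h3, h4]
  field_simp
  ring

lemma tendsto_coeff_sqrtOneSub :
    Tendsto (fun n : ℕ => coeff n sqrtOneSub * ((n : ℝ) + 1) ^ (3 / 2 : ℝ)) atTop
      (𝓝 (-(1 / (2 * √Real.pi)))) := by
  rw [← tendsto_add_atTop_iff_nat 1]
  push_cast
  simp_rw [add_assoc]
  refine tendsto_rpow_weight_congr (b := 0) (by norm_num) le_rfl ?_
  have h1 : Tendsto (fun n : ℕ => (n : ℝ) / (n + 1)) atTop (𝓝 1) :=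
    tendsto_natCast_div_add_atTop 1
  have h2 := ((tendsto_centralBinom_mul_sqrt.mul h1).const_mul (-(1 / 2)))
  convert h2 using 2 with n
  · rw [coeff_succ_sqrtOneSub, add_zero, show (3 / 2 : ℝ) = 1 + 1 / 2 by norm_num,
      Real.rpow_add' (by positivity) (by norm_num), Real.rpow_one, ← Real.sqrt_eq_rpow]
    field_simp
  · field_simp

end SquareRoot

section MajorantNorm

/-- The partial sums of the weighted `ℓ¹` norm of a power series. -/
noncomputable def partialNorm (R : ℝ) (f : ℝ⟦X⟧) (N : ℕ) : ℝ :=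
  ∑ n ∈ Finset.range N, |coeff n f| * R ^ n

variable {R : ℝ}

lemma partialNorm_nonneg (hR : 0 ≤ R) (f : ℝ⟦X⟧) (N : ℕ) : 0 ≤ partialNorm R f N :=
  Finset.sum_nonneg fun _ _ => by positivity

lemma partialNorm_add_le (hR : 0 ≤ R) (f g : ℝ⟦X⟧) (N : ℕ) :
    partialNorm R (f + g) N ≤ partialNorm R f N + partialNorm R g N := by
  rw [partialNorm, partialNorm, partialNorm, ← Finset.sum_add_distrib]
  gcongr with n
  rw [← add_mul, map_add]
  gcongr
  exact abs_add_le _ _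

lemma partialNorm_C_mul (a : ℝ) (f : ℝ⟦X⟧) (N : ℕ) :
    partialNorm R (C a * f) N = |a| * partialNorm R f N := by
  simp only [partialNorm, coeff_C_mul, abs_mul, Finset.mul_sum, mul_assoc]

lemma partialNorm_X_mul (f : ℝ⟦X⟧) (N : ℕ) :
    partialNorm R (X * f) (N + 1) = R * partialNorm R f N := by
  simp only [partialNorm, Finset.sum_range_succ', coeff_succ_X_mul, Finset.mul_sum]
  simp only [coeff_zero_X_mul, abs_zero, zero_mul, add_zero]
  exact Finset.sum_congr rfl fun n _ => by ring

lemma partialNorm_mul_le (hR : 0 ≤ R) (f g : ℝ⟦X⟧) (N : ℕ) :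
    partialNorm R (f * g) N ≤ partialNorm R f N * partialNorm R g N := by
  calc partialNorm R (f * g) N
      ≤ ∑ n ∈ Finset.range N, ∑ k ∈ Finset.range (n + 1),
          (|coeff k f| * R ^ k) * (|coeff (n - k) g| * R ^ (n - k)) := by
        rw [partialNorm]
        gcongr with n
        rw [coeff_mul,
          Finset.Nat.sum_antidiagonal_eq_sum_range_succ (fun i j => coeff i f * coeff j g)]
        calc _ ≤ (∑ k ∈ Finset.range (n + 1), |coeff k f * coeff (n - k) g|) * R ^ n := by
              gcongr
              exact Finset.abs_sum_le_sum_abs _ _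
          _ = _ := by
              rw [Finset.sum_mul]
              refine Finset.sum_congr rfl fun k hk => ?_
              obtain ⟨m, rfl⟩ := Nat.exists_eq_add_of_le
                (Nat.lt_succ_iff.1 (Finset.mem_range.1 hk))
              rw [Nat.add_sub_cancel_left, abs_mul, pow_add]
              ring
    _ = ∑ m ∈ Finset.range N, ∑ k ∈ Finset.range (N - m),
          (|coeff m f| * R ^ m) * (|coeff k g| * R ^ k) :=
        Finset.sum_range_diag_flip N
          fun i j => (|coeff i f| * R ^ i) * (|coeff j g| * R ^ j)
    _ ≤ ∑ m ∈ Finset.range N, ∑ k ∈ Finset.range N,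
          (|coeff m f| * R ^ m) * (|coeff k g| * R ^ k) := by
        gcongr with m
        omega
    _ = partialNorm R f N * partialNorm R g N := by
        rw [partialNorm, partialNorm, Finset.sum_mul_sum]

/-- The power series `E = √(1 + A) - 1` is majorized by `1 - √(1 - |A|)`. -/
lemma partialNorm_le_one_of_sq_eq (hR : 0 ≤ R) {E A : ℝ⟦X⟧} (hE : constantCoeff E = 0)
    (h : 2 * E + E ^ 2 = A) (hA : ∀ N, partialNorm R A N ≤ 1) (N : ℕ) :
    partialNorm R E N ≤ 1 := by
  induction N with
  | zero => simp [partialNorm]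
  | succ N ih =>
    obtain ⟨E', rfl⟩ := X_dvd_iff.2 hE
    have h1 : C 2 * (X * E') = A + C (-1) * (X * (E' * (X * E'))) := by
      rw [map_neg, map_one, map_ofNat, ← h]
      ring
    have h2 := congrArg (fun f => partialNorm R f (N + 1)) h1
    simp only [partialNorm_C_mul] at h2
    have h3 := partialNorm_add_le hR A (C (-1) * (X * (E' * (X * E')))) (N + 1)
    rw [partialNorm_C_mul, partialNorm_X_mul] at h3
    have h4 := partialNorm_mul_le hR E' (X * E') N
    have h5 := partialNorm_X_mul (R := R) E' N
    have h6 := partialNorm_nonneg hR E' N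
    have h7 : R * partialNorm R (E' * (X * E')) N ≤ R * partialNorm R E' N := by
      gcongr
      exact h4.trans (mul_le_of_le_one_right h6 ih)
    norm_num at h2 h3
    linarith [hA (N + 1)]

end MajorantNorm

section Asymptotics

variable {ρ : ℝ}

lemma root_mem_bounds (hρ : ρ ∈ Set.Ioo (0 : ℝ) 1)
    (hroot : ρ ^ 3 + ρ ^ 2 + 3 * ρ = 1) : 29 / 100 < ρ ∧ ρ < 3 / 10 := by
  obtain ⟨h0, -⟩ := hρ
  constructor
  · by_contra! h
    have h2 : ρ ^ 2 ≤ (29 / 100) ^ 2 := by gcongr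
    have h3 : ρ ^ 3 ≤ (29 / 100) ^ 3 := by gcongr
    linarith
  · by_contra! h
    have h2 : (3 / 10) ^ 2 ≤ ρ ^ 2 := by gcongr
    have h3 : (3 / 10) ^ 3 ≤ ρ ^ 3 := by gcongr
    linarith

/-- The geometric series with ratio `ρ`. -/
noncomputable def geomSeries (ρ : ℝ) : ℝ⟦X⟧ := mk fun n => ρ ^ n

lemma geomSeries_mul (ρ : ℝ) : geomSeries ρ * (1 - C ρ * X) = 1 := by
  have h := congrArg (rescale ρ) (mk_one_mul_one_sub_eq_one ℝ)
  simpa [geomSeries, rescale_mk, rescale_X] using h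

/-- The factor of the rescaled series `discSqrt` which is regular at the dominant singularity. -/
noncomputable def regularFactor (ρ : ℝ) : ℝ⟦X⟧ := rescale ρ discSqrt * sqrtOneSub⁻¹

lemma rescale_discSqrt (ρ : ℝ) : rescale ρ discSqrt = sqrtOneSub * regularFactor ρ := by
  rw [regularFactor, mul_comm, mul_assoc, PowerSeries.inv_mul_cancel, mul_one]
  simp [constantCoeff_sqrtOneSub]

lemma constantCoeff_regularFactor (ρ : ℝ) : constantCoeff (regularFactor ρ) = 1 := by
  have h := congrArg constantCoeff (rescale_discSqrt ρ)
  rw [map_mul, constantCoeff_sqrtOneSub, one_mul] at h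
  rw [← h, ← coeff_zero_eq_constantCoeff_apply, coeff_rescale]
  simp [discSqrt]

/-- The cofactor of `1 - X` in the rescaled polynomial `1 - 3 X - X ^ 2 - X ^ 3`. -/
noncomputable def cofactor (ρ : ℝ) : ℝ⟦X⟧ := 1 + C (ρ ^ 2 + ρ ^ 3) * X + C (ρ ^ 3) * X ^ 2

lemma regularFactor_sq_mul (hroot : ρ ^ 3 + ρ ^ 2 + 3 * ρ = 1) :
    regularFactor ρ ^ 2 * (1 - C ρ * X) = cofactor ρ := by
  have h := congrArg (rescale ρ) discSqrt_sq_mul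
  have h3 : (3 : ℝ⟦X⟧) = C 3 := (map_ofNat C 3).symm
  simp only [map_mul, map_pow, map_sub, map_one, rescale_X, rescale_discSqrt, map_ofNat] at h
  have hC : (C ρ : ℝ⟦X⟧) ^ 3 + C ρ ^ 2 + 3 * C ρ = 1 := by
    rw [h3, ← map_pow, ← map_pow, ← map_mul, ← map_add, ← map_add, hroot, map_one]
  have h0 : (1 - X : ℝ⟦X⟧) ≠ 0 := fun h => by simpa using congrArg constantCoeff h
  apply mul_right_cancel₀ h0
  rw [cofactor, map_add, map_pow, map_pow]
  linear_combination h - regularFactor ρ ^ 2 * (1 - C ρ * X) * sqrtOneSub_sq - X * hC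

lemma partialNorm_cofactor_mul_geomSeries_sub_one_le (hρ : ρ ∈ Set.Ioo (0 : ℝ) 1)
    (hroot : ρ ^ 3 + ρ ^ 2 + 3 * ρ = 1) (N : ℕ) :
    partialNorm (5 / 4) (cofactor ρ * geomSeries ρ - 1) N ≤ 1 := by
  obtain ⟨hl, hu⟩ := root_mem_bounds hρ hroot
  set A := cofactor ρ * geomSeries ρ - 1 with hA
  have hrec : A = C ρ * (X * A) + (C (1 - 2 * ρ) * (X * 1) + C (ρ ^ 3) * (X * (X * 1))) := by
    have h := geomSeries_mul ρ
    have hC : (C (1 - 2 * ρ) : ℝ⟦X⟧) = C (ρ ^ 2 + ρ ^ 3) + C ρ := by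
      rw [← map_add]; congr 1; linarith
    rw [hA, hC]
    have hQ : cofactor ρ = 1 + C (ρ ^ 2 + ρ ^ 3) * X + C (ρ ^ 3) * X ^ 2 := rfl
    linear_combination cofactor ρ * h + hQ
  have hone (N : ℕ) : partialNorm (5 / 4) 1 N ≤ 1 := by
    cases N with
    | zero => simp [partialNorm]
    | succ N => simp [partialNorm, Finset.sum_range_succ', coeff_one]
  have hX (N : ℕ) : partialNorm (5 / 4) (X * 1) N ≤ 5 / 4 := by
    cases N with
    | zero => norm_num [partialNorm]
    | succ N => rw [partialNorm_X_mul]; linarith [hone N]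
  induction N with
  | zero => simp [partialNorm]
  | succ N ih =>
    have h1 := congrArg (fun f => partialNorm (5 / 4) f (N + 1)) hrec
    have h2 := partialNorm_add_le (R := 5 / 4) (by norm_num) (C ρ * (X * A))
      (C (1 - 2 * ρ) * (X * 1) + C (ρ ^ 3) * (X * (X * 1))) (N + 1)
    have h3 := partialNorm_add_le (R := 5 / 4) (by norm_num)
      (C (1 - 2 * ρ) * (X * 1)) (C (ρ ^ 3) * (X * (X * 1))) (N + 1)
    simp only [partialNorm_C_mul, partialNorm_X_mul] at h1 h2 h3
    rw [abs_of_pos (by linarith : 0 < ρ)] at h2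
    rw [abs_of_pos (by linarith : 0 < 1 - 2 * ρ), abs_of_pos (by positivity : 0 < ρ ^ 3)] at h3
    have h4 : ρ * (5 / 4 * partialNorm (5 / 4) A N) ≤ ρ * (5 / 4 * 1) := by gcongr
    have h5 : (1 - 2 * ρ) * (5 / 4 * partialNorm (5 / 4) 1 N) ≤ (1 - 2 * ρ) * (5 / 4 * 1) := by
      gcongr
      · linarith
      · exact hone N
    have h6 : ρ ^ 3 * (5 / 4 * partialNorm (5 / 4) (X * 1) N) ≤
        (3 / 10) ^ 3 * (5 / 4 * (5 / 4)) := by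
      have := partialNorm_nonneg (R := 5 / 4) (by norm_num) (X * 1) N
      gcongr
      exact hX N
    linarith

lemma partialNorm_regularFactor_sub_one_le (hρ : ρ ∈ Set.Ioo (0 : ℝ) 1)
    (hroot : ρ ^ 3 + ρ ^ 2 + 3 * ρ = 1) (N : ℕ) :
    partialNorm (5 / 4) (regularFactor ρ - 1) N ≤ 1 := by
  refine partialNorm_le_one_of_sq_eq (by norm_num) ?_ ?_
    (partialNorm_cofactor_mul_geomSeries_sub_one_le hρ hroot) N
  · simp [constantCoeff_regularFactor]
  · linear_combination geomSeries ρ * regularFactor_sq_mul hroot -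
      regularFactor ρ ^ 2 * geomSeries_mul ρ

lemma abs_coeff_regularFactor_le (hρ : ρ ∈ Set.Ioo (0 : ℝ) 1)
    (hroot : ρ ^ 3 + ρ ^ 2 + 3 * ρ = 1) (n : ℕ) :
    |coeff n (regularFactor ρ)| ≤ (4 / 5) ^ n := by
  cases n with
  | zero => simp [constantCoeff_regularFactor]
  | succ n =>
    have h1 := partialNorm_regularFactor_sub_one_le hρ hroot (n + 2)
    rw [partialNorm, Finset.sum_range_succ] at h1
    have h2 : |coeff (n + 1) (regularFactor ρ - 1)| * (5 / 4) ^ (n + 1) ≤ 1 :=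
      (le_add_of_nonneg_left (Finset.sum_nonneg fun _ _ => by positivity)).trans h1
    rw [map_sub, coeff_one, if_neg n.succ_ne_zero, sub_zero, ← le_div_iff₀ (by positivity)] at h2
    rwa [show (4 / 5 : ℝ) = (5 / 4)⁻¹ by norm_num, inv_pow, ← one_div]

lemma summable_abs_coeff {f : ℝ⟦X⟧} {r : ℝ} (hr : 0 ≤ r) (hr1 : r < 1)
    (hf : ∀ n, |coeff n f| ≤ r ^ n) : Summable fun n => |coeff n f| :=
  Summable.of_nonneg_of_le (fun _ => abs_nonneg _) hf (summable_geometric_of_lt_one hr hr1)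

lemma abs_coeff_geomSeries_le (hρ : 0 ≤ ρ) (n : ℕ) : |coeff n (geomSeries ρ)| ≤ ρ ^ n := by
  rw [geomSeries, coeff_mk, abs_of_nonneg (by positivity)]

lemma tsum_coeff_geomSeries (hρ : ρ ∈ Set.Ioo (0 : ℝ) 1) :
    ∑' n, coeff n (geomSeries ρ) = (1 - ρ)⁻¹ := by
  simp only [geomSeries, coeff_mk]
  exact tsum_geometric_of_lt_one hρ.1.le hρ.2

lemma coeff_cofactor (ρ : ℝ) (n : ℕ) :
    coeff n (cofactor ρ) = (if n = 0 then 1 else 0) +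
      (ρ ^ 2 + ρ ^ 3) * (if n = 1 then 1 else 0) + ρ ^ 3 * (if n = 2 then 1 else 0) := by
  rw [cofactor, map_add (coeff n), map_add (coeff n), coeff_C_mul, coeff_C_mul, coeff_one,
    coeff_X, coeff_X_pow]

lemma coeff_cofactor_of_three_le (ρ : ℝ) {n : ℕ} (hn : 3 ≤ n) : coeff n (cofactor ρ) = 0 := by
  simp [coeff_cofactor, show n ≠ 0 by omega, show n ≠ 1 by omega, show n ≠ 2 by omega]

lemma tsum_coeff_cofactor (hroot : ρ ^ 3 + ρ ^ 2 + 3 * ρ = 1) :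
    ∑' n, coeff n (cofactor ρ) = ρ * (3 + 2 * ρ + 3 * ρ ^ 2) := by
  rw [tsum_eq_sum (s := Finset.range 3) fun n hn =>
    coeff_cofactor_of_three_le ρ (by simpa using hn)]
  simp [Finset.sum_range_succ, coeff_cofactor]
  linarith

lemma tsum_coeff_regularFactor (hρ : ρ ∈ Set.Ioo (0 : ℝ) 1)
    (hroot : ρ ^ 3 + ρ ^ 2 + 3 * ρ = 1) :
    ∑' n, coeff n (regularFactor ρ) = √(ρ * (3 + 2 * ρ + 3 * ρ ^ 2) / (1 - ρ)) := by
  have hG := summable_abs_coeff (by norm_num) (by norm_num) (abs_coeff_regularFactor_le hρ hroot)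
  have hgeom := summable_abs_coeff hρ.1.le hρ.2 (abs_coeff_geomSeries_le hρ.1.le)
  have hQ : Summable fun n => |coeff n (cofactor ρ)| :=
    summable_of_ne_finset_zero (s := Finset.range 3) fun n hn => by
      rw [coeff_cofactor_of_three_le ρ (by simpa using hn), abs_zero]
  have hsq : regularFactor ρ * regularFactor ρ = cofactor ρ * geomSeries ρ := by
    linear_combination geomSeries ρ * regularFactor_sq_mul hroot -
      regularFactor ρ ^ 2 * geomSeries_mul ρ
  have h := congrArg (fun f => ∑' n, coeff n f) hsq
  simp only [tsum_coeff_mul hG hG, tsum_coeff_mul hQ hgeom, tsum_coeff_cofactor hroot,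
    tsum_coeff_geomSeries hρ] at h
  rw [div_eq_mul_inv, ← h, Real.sqrt_mul_self]
  refine ge_of_tendsto' hG.of_abs.hasSum.tendsto_sum_nat fun N => ?_
  cases N with
  | zero => simp
  | succ N =>
    have h1 := partialNorm_regularFactor_sub_one_le hρ hroot (N + 1)
    have h2 : ∑ n ∈ Finset.range (N + 1), coeff n (regularFactor ρ) =
        1 + ∑ n ∈ Finset.range (N + 1), coeff n (regularFactor ρ - 1) := by
      simp [Finset.sum_range_succ', coeff_one, constantCoeff_regularFactor, add_comm]
    have h3 : -∑ n ∈ Finset.range (N + 1), coeff n (regularFactor ρ - 1) ≤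
        partialNorm (5 / 4) (regularFactor ρ - 1) (N + 1) := by
      rw [← Finset.sum_neg_distrib, partialNorm]
      gcongr with n
      exact (neg_le_abs _).trans
        (le_mul_of_one_le_right (abs_nonneg _) (one_le_pow₀ (by norm_num)))
    linarith

lemma rescale_hnfSeries (ρ : ℝ) :
    2 * rescale ρ hnfSeries =
      2 * geomSeries ρ - 1 - sqrtOneSub * regularFactor ρ * geomSeries ρ := by
  have h := congrArg (rescale ρ) two_mul_hnfSeries_mul
  simp only [map_mul, map_add, map_sub, map_one, rescale_X, rescale_discSqrt, map_ofNat] at h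
  linear_combination geomSeries ρ * h - (2 * rescale ρ hnfSeries + 1) * geomSeries_mul ρ

end Asymptotics

theorem hnf_asymptotics (ρ : ℝ) (hρ : ρ ∈ Set.Ioo (0 : ℝ) 1)
    (hroot : ρ ^ 3 + ρ ^ 2 + 3 * ρ = 1) :
    Filter.Tendsto
      (fun n : ℕ => (H n : ℝ) * ρ ^ n * (n : ℝ) ^ ((3 : ℝ) / 2))
      Filter.atTop
      (nhds (Real.sqrt (ρ * (3 + 2 * ρ + 3 * ρ ^ 2) / (1 - ρ)) /
        (4 * (1 - ρ) * Real.sqrt Real.pi))) := by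
  have hG := tendsto_coeff_mul_rpow tendsto_coeff_sqrtOneSub
    (summable_coeff_mul_rpow (by norm_num) (by norm_num) (abs_coeff_regularFactor_le hρ hroot))
  have hF := tendsto_coeff_mul_rpow hG
    (summable_coeff_mul_rpow hρ.1 hρ.2 (abs_coeff_geomSeries_le hρ.1.le))
  rw [tsum_coeff_regularFactor hρ hroot, tsum_coeff_geomSeries hρ] at hF
  have hH := (tendsto_pow_mul_rpow hρ.1 hρ.2).sub (hF.const_mul (1 / 2))
  have h1ρ : 1 - ρ ≠ 0 := (sub_pos.2 hρ.2).ne'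
  suffices h : Tendsto (fun n : ℕ => (H n : ℝ) * ρ ^ n * ((n : ℝ) + 1) ^ (3 / 2 : ℝ)) atTop
      (𝓝 (√(ρ * (3 + 2 * ρ + 3 * ρ ^ 2) / (1 - ρ)) / (4 * (1 - ρ) * √Real.pi))) by
    simpa using tendsto_rpow_weight_congr le_rfl zero_le_one h
  convert hH.congr' ?_ using 2
  · field_simp
    ring
  filter_upwards [eventually_gt_atTop 0] with n hn
  have h := congrArg (coeff n) (rescale_hnfSeries ρ)
  simp only [two_mul, map_sub, map_add, coeff_rescale, coeff_one, if_neg hn.ne', hnfSeries,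
    coeff_mk] at h
  rw [show coeff n (geomSeries ρ) = ρ ^ n from coeff_mk _ _] at h
  have h' : (H n : ℝ) * ρ ^ n =
      ρ ^ n - 1 / 2 * coeff n (sqrtOneSub * regularFactor ρ * geomSeries ρ) := by
    linarith
  rw [h']
  ring
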